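/- For every w ∈ C¹(Ω̄) vanishing on ∂Ω and every p ∈ C¹(Ω̄; ℝ^d), with C_v = sup_{x∈Ω} |v(x)|² and C_α = sup_{x∈Ω} α(x)², the following three bounds hold: (a) ‖w‖²_{L²(Ω)} + ‖∇w‖²_{L²(Ω)} ≤ (2(1 + C_pf²)² / (γ_min² λ_min²)) F_Prim(w, p); (b) ‖p‖²_{L²(Ω)} ≤ (1 + 2 C_v C_pf² (1 + C_pf²)/λ_min² + 2(1 + C_pf²) λ_max²/λ_min²) · (4 F_Prim(w, p) / γ_min²); (c) ‖div p‖²_{L²(Ω)} ≤ (1 + C_α C_pf² (1 + C_pf²)/λ_min²) · (4 F_Prim(w, p) / γ_min²). -/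

import Mathlib

open MeasureTheory Matrix Set

/-- Gradient of a scalar field on `ℝ^d` (as `Fin d → ℝ`). -/
noncomputable def sgrad {d : ℕ} (f : (Fin d → ℝ) → ℝ) (x : Fin d → ℝ) : Fin d → ℝ :=
  fun i => fderiv ℝ f x (Pi.single i 1)

/-- Divergence of a vector field on `ℝ^d` (as `Fin d → ℝ`). -/
noncomputable def sdiv {d : ℕ} (F : (Fin d → ℝ) → (Fin d → ℝ)) (x : Fin d → ℝ) : ℝ :=
  ∑ i, fderiv ℝ (fun y => F y i) x (Pi.single i 1)

/-- The homogeneous (f = 0, full Dirichlet boundary) weighted primitive least-squares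
functional
`F_Prim(w, p) = (1/2)∫_Ω |A(x)(p − w v + D ∇w)|² dx + (1/2)∫_Ω β(x)²(α w + div p)² dx`. -/
noncomputable def FPrim {d : ℕ} (Ω : Set (Fin d → ℝ))
    (A Dm : (Fin d → ℝ) → Matrix (Fin d) (Fin d) ℝ)
    (β α : (Fin d → ℝ) → ℝ) (v : (Fin d → ℝ) → (Fin d → ℝ))
    (w : (Fin d → ℝ) → ℝ) (p : (Fin d → ℝ) → (Fin d → ℝ)) : ℝ :=
  (1 / 2) * (∫ x in Ω,
    ((A x).mulVec (fun i => p x i - w x * v x i + (Dm x).mulVec (sgrad w x) i)) ⬝ᵥ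
      ((A x).mulVec (fun i => p x i - w x * v x i + (Dm x).mulVec (sgrad w x) i))) +
  (1 / 2) * (∫ x in Ω, (β x) ^ 2 * (α x * w x + sdiv p x) ^ 2)

theorem aux_fderiv_bdd {d : ℕ} {Ω : Set (Fin d → ℝ)} (hΩo : IsOpen Ω)
    (hΩb : Bornology.IsBounded Ω) {f : (Fin d → ℝ) → ℝ}
    (hf : ContDiffOn ℝ 1 f (closure Ω)) :
    ∃ C, ∀ x ∈ Ω, ‖fderiv ℝ f x‖ ≤ C := by
  have hK : IsCompact (closure Ω) := hΩb.isCompact_closure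
  have key : ∃ C, ∀ x ∈ closure Ω ∩ Ω, ‖fderiv ℝ f x‖ ≤ C := by
    refine hK.induction_on (p := fun s => ∃ C, ∀ x ∈ s ∩ Ω, ‖fderiv ℝ f x‖ ≤ C) ?_ ?_ ?_ ?_
    · exact ⟨0, by simp⟩
    · rintro s t hst ⟨C, hC⟩
      exact ⟨C, fun x hx => hC x ⟨hst hx.1, hx.2⟩⟩
    · rintro s t ⟨C, hC⟩ ⟨C', hC'⟩
      refine ⟨max C C', ?_⟩
      rintro x ⟨hx | hx, hxΩ⟩
      · exact (hC x ⟨hx, hxΩ⟩).trans (le_max_left _ _)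
      · exact (hC' x ⟨hx, hxΩ⟩).trans (le_max_right _ _)
    · intro x hx
      have h1 : ContDiffWithinAt ℝ (0 + 1) f (closure Ω) x := by simpa using hf x hx
      obtain ⟨u, hu, -, f', hf', hc⟩ :=
        (contDiffWithinAt_succ_iff_hasFDerivWithinAt (by simp)).1 h1
      rw [insert_eq_of_mem hx] at hu
      have hcont := hc.continuousWithinAt
      have hxu : x ∈ u := mem_of_mem_nhdsWithin hx hu
      have hb : ∀ᶠ y in nhdsWithin x u, ‖f' y‖ ≤ ‖f' x‖ + 1 := by
        have := hcont.norm.eventually (gt_mem_nhds (lt_add_one ‖f' x‖))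
        exact this.mono fun y hy => le_of_lt hy
      obtain ⟨O, hO, hxO, hOu⟩ := mem_nhdsWithin.1 hu
      obtain ⟨O', hO', hxO', hOb⟩ := mem_nhdsWithin.1 hb
      refine ⟨O ∩ O', mem_nhdsWithin_of_mem_nhds ((hO.inter hO').mem_nhds ⟨hxO, hxO'⟩),
        ‖f' x‖ + 1, ?_⟩
      rintro y ⟨⟨hyO, hyO'⟩, hyΩ⟩
      have hyu : y ∈ u := hOu ⟨hyO, subset_closure hyΩ⟩
      have hun : u ∈ nhds y :=
        Filter.mem_of_superset ((hO.inter hΩo).mem_nhds ⟨hyO, hyΩ⟩)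
          fun z hz => hOu ⟨hz.1, subset_closure hz.2⟩
      rw [((hf' y hyu).hasFDerivAt hun).fderiv]
      exact hOb ⟨hyO', hyu⟩
  obtain ⟨C, hC⟩ := key
  exact ⟨C, fun x hx => hC x ⟨subset_closure hx, hx⟩⟩

theorem aux_exit {d : ℕ} {Ω : Set (Fin d → ℝ)} (hΩo : IsOpen Ω) {g : (Fin d → ℝ) → ℝ}
    (hgc : ContinuousOn g (closure Ω)) (hg0 : ∀ y ∈ frontier Ω, g y = 0)
    (hgd : DifferentiableOn ℝ g Ω) {C : ℝ} (hC : ∀ x ∈ Ω, ‖fderiv ℝ g x‖ ≤ C)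
    {x z : Fin d → ℝ} (hx : x ∈ Ω) (hz : z ∉ Ω) : ‖g x‖ ≤ C * ‖z - x‖ := by
  have hC0 : 0 ≤ C := (norm_nonneg _).trans (hC x hx)
  set φ : ℝ → (Fin d → ℝ) := fun t => x + t • (z - x) with hφ
  have hφc : Continuous φ := by fun_prop
  have hφd : ∀ t, HasDerivAt φ (z - x) t := by
    intro t
    have h := ((hasDerivAt_id t).smul_const (z - x)).const_add x
    rw [one_smul] at h
    exact h
  set T : Set ℝ := Icc 0 1 ∩ φ ⁻¹' Ωᶜ with hT
  have hTc : IsClosed T := isClosed_Icc.inter (hΩo.isClosed_compl.preimage hφc)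
  have h1T : (1 : ℝ) ∈ T := ⟨by simp, by simpa [hφ] using hz⟩
  have hTb : BddBelow T := ⟨0, fun t ht => ht.1.1⟩
  set s := sInf T with hs
  have hsT : s ∈ T := hTc.csInf_mem ⟨1, h1T⟩ hTb
  have hlt : ∀ t, 0 ≤ t → t < s → φ t ∈ Ω := by
    intro t h0 h1
    by_contra hcon
    exact absurd (csInf_le hTb (⟨⟨h0, h1.le.trans hsT.1.2⟩, hcon⟩ : t ∈ T)) (not_le.2 h1)
  have hs0 : 0 < s := by
    rcases hsT.1.1.eq_or_lt with h | h
    · exfalso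
      have := hsT.2
      rw [← h] at this
      simp [hφ] at this
      exact this hx
    · exact h
  have hmem : ∀ t ∈ Icc 0 s, φ t ∈ closure Ω := by
    have h1 : closure (Ico 0 s) ⊆ φ ⁻¹' (closure Ω) := by
      refine closure_minimal ?_ (isClosed_closure.preimage hφc)
      exact fun t ht => subset_closure (hlt t ht.1 ht.2)
    rw [closure_Ico hs0.ne] at h1
    exact h1
  have hfr : g (φ s) = 0 := by
    apply hg0
    rw [hΩo.frontier_eq]
    exact ⟨hmem s ⟨hs0.le, le_rfl⟩, hsT.2⟩
  have := norm_image_sub_le_of_norm_deriv_right_le_segment (f := g ∘ φ)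
    (f' := fun t => fderiv ℝ g (φ t) (z - x)) (C := C * ‖z - x‖) (a := 0) (b := s)
    (hgc.comp hφc.continuousOn hmem)
    (fun t ht => by
      have h1 : HasFDerivAt g (fderiv ℝ g (φ t)) (φ t) :=
        (hgd.differentiableAt (hΩo.mem_nhds (hlt t ht.1 ht.2))).hasFDerivAt
      exact (h1.comp_hasDerivAt t (hφd t)).hasDerivWithinAt)
    (fun t ht => (ContinuousLinearMap.le_opNorm _ _).trans
      (mul_le_mul_of_nonneg_right (hC _ (hlt t ht.1 ht.2)) (norm_nonneg _)))
    s ⟨hs0.le, le_rfl⟩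
  simp only [Function.comp, hfr, zero_sub, norm_neg, sub_zero] at this
  have h0 : φ 0 = x := by simp [hφ]
  rw [h0] at this
  refine this.trans (mul_le_of_le_one_right (by positivity) hsT.1.2)

theorem aux_lip {d : ℕ} {Ω : Set (Fin d → ℝ)} (hΩo : IsOpen Ω) {g : (Fin d → ℝ) → ℝ}
    (hgc : ContinuousOn g (closure Ω)) (hg0 : ∀ y ∈ frontier Ω, g y = 0)
    (hgd : DifferentiableOn ℝ g Ω) {C : NNReal} (hC : ∀ x ∈ Ω, ‖fderiv ℝ g x‖ ≤ C) :
    LipschitzWith C (Ω.indicator g) := by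
  have hout : ∀ x z, z ∉ Ω → ‖Ω.indicator g x‖ ≤ C * ‖z - x‖ := by
    intro x z hz
    by_cases hx : x ∈ Ω
    · rw [indicator_of_mem hx]
      exact aux_exit hΩo hgc hg0 hgd hC hx hz
    · rw [indicator_of_notMem hx]
      simp only [norm_zero]; positivity
  refine LipschitzWith.of_dist_le_mul fun x y => ?_
  rw [dist_eq_norm, dist_eq_norm]
  by_cases hseg : segment ℝ x y ⊆ Ω
  · rw [indicator_of_mem (hseg (left_mem_segment ℝ x y)),
      indicator_of_mem (hseg (right_mem_segment ℝ x y))]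
    exact (convex_segment x y).norm_image_sub_le_of_norm_hasFDerivWithin_le
      (f' := fun z => fderiv ℝ g z)
      (fun z hz => (hgd.differentiableAt (hΩo.mem_nhds (hseg hz))).hasFDerivAt.hasFDerivWithinAt)
      (fun z hz => hC z (hseg hz)) (right_mem_segment ℝ x y) (left_mem_segment ℝ x y)
  · obtain ⟨z, hz, hzΩ⟩ := not_subset.1 hseg
    have h1 := hout x z hzΩ
    have h2 := hout y z hzΩ
    have h3 := dist_add_dist_of_mem_segment hz
    rw [dist_eq_norm, dist_eq_norm, dist_eq_norm, norm_sub_rev x z] at h3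
    rw [← h3, mul_add]
    exact (norm_sub_le _ _).trans (add_le_add h1 h2)

theorem aux_null {d : ℕ} (hd : 1 ≤ d) {s : Set (Fin d → ℝ)} (hs : MeasurableSet s)
    {h : (Fin d → ℝ) → ℝ} (h0 : ∀ x ∈ s, h x = 0) (hdiff : ∀ᵐ x, DifferentiableAt ℝ h x) :
    ∀ᵐ x, x ∈ s → fderiv ℝ h x = 0 := by
  obtain ⟨t, hts, htm, htae⟩ : ∃ t ⊆ s, MeasurableSet t ∧ (∀ᵐ x, x ∈ s → x ∈ t) ∧
      ∀ x ∈ t, DifferentiableAt ℝ h x := by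
    refine ⟨s ∩ {x | DifferentiableAt ℝ h x}, inter_subset_left,
      hs.inter (measurableSet_of_differentiableAt ℝ h), ?_, fun x hx => hx.2⟩
    filter_upwards [hdiff] with x hx hxs using ⟨hxs, hx⟩
  let e : Fin d → ℝ := Pi.single ⟨0, hd⟩ 1
  have key := ApproximatesLinearOn.norm_fderiv_sub_le (μ := volume) (s := t) (δ := 0)
    (f := fun x => h x • e) (A := 0)
    (by
      intro x hx y hy
      simp [h0 x (hts hx), h0 y (hts hy)]) htm
    (fun x => (fderiv ℝ h x).smulRight e)
    (fun x hx => ((htae.2 x hx).hasFDerivAt.smul_const e).hasFDerivWithinAt)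
  rw [ae_restrict_iff' htm] at key
  filter_upwards [key, htae.1] with x hx hxt hxs
  have h1 := hx (hxt hxs)
  simp only [sub_zero, nonpos_iff_eq_zero, nnnorm_eq_zero] at h1
  ext y
  have h2 := congrFun (congrArg (fun L => L y) h1) ⟨0, hd⟩
  simpa [e] using h2

theorem aux_ibp {d : ℕ} (hd : 1 ≤ d) {Ω : Set (Fin d → ℝ)} (hΩo : IsOpen Ω)
    (hΩb : Bornology.IsBounded Ω) {g : (Fin d → ℝ) → ℝ}
    (hg : ContDiffOn ℝ 1 g (closure Ω)) (hg0 : ∀ y ∈ frontier Ω, g y = 0) (e : Fin d → ℝ) :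
    ∫ x in Ω, fderiv ℝ g x e = 0 := by
  obtain ⟨C, hC⟩ := aux_fderiv_bdd hΩo hΩb hg
  have hgd : DifferentiableOn ℝ g Ω := (hg.differentiableOn (by simp)).mono subset_closure
  have hlip : LipschitzWith C.toNNReal (Ω.indicator g) :=
    aux_lip hΩo hg.continuousOn hg0 hgd
      (fun x hx => (hC x hx).trans (Real.le_coe_toNNReal C))
  have hcs : HasCompactSupport (Ω.indicator g) := by
    refine HasCompactSupport.intro hΩb.isCompact_closure fun x hx => ?_
    exact indicator_of_notMem (fun h => hx (subset_closure h)) _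
  have hint := LipschitzWith.integral_lineDeriv_mul_eq (μ := volume) (D := C.toNNReal)
    (LipschitzWith.const (1 : ℝ) : LipschitzWith 0 (fun _ : Fin d → ℝ => (1 : ℝ))) hlip hcs (-e)
  have hae := hlip.ae_differentiableAt (μ := volume)
  have hnull := aux_null hd hΩo.measurableSet.compl
    (fun x hx => indicator_of_notMem hx g) hae
  simp only [neg_neg, mul_one, lineDeriv, deriv_const, zero_mul, integral_zero] at hint
  change 0 = ∫ x, lineDeriv ℝ (Ω.indicator g) x e at hint
  have h2 : ∫ x in Ω, lineDeriv ℝ (Ω.indicator g) x e = ∫ x, lineDeriv ℝ (Ω.indicator g) x e := by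
    apply setIntegral_eq_integral_of_ae_compl_eq_zero
    filter_upwards [hae, hnull] with x h1 h2 h3
    rw [h1.lineDeriv_eq_fderiv, h2 h3]; rfl
  rw [← h2] at hint
  rw [hint]
  refine setIntegral_congr_fun hΩo.measurableSet fun x hx => ?_
  have hEq : Ω.indicator g =ᶠ[nhds x] g := by
    filter_upwards [hΩo.mem_nhds hx] with y hy using indicator_of_mem hy g
  have hd1 := hgd.differentiableAt (hΩo.mem_nhds hx)
  have hd2 : DifferentiableAt ℝ (Ω.indicator g) x := hEq.differentiableAt_iff.2 hd1
  change fderiv ℝ g x e = lineDeriv ℝ (Ω.indicator g) x e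
  rw [hd2.lineDeriv_eq_fderiv, hEq.fderiv_eq]

/-- Continuous and bounded on `Ω`. -/
def AuxGood {d : ℕ} (Ω : Set (Fin d → ℝ)) (f : (Fin d → ℝ) → ℝ) : Prop :=
  ContinuousOn f Ω ∧ ∃ C, ∀ x ∈ Ω, |f x| ≤ C

namespace AuxGood

variable {d : ℕ} {Ω : Set (Fin d → ℝ)} {f g : (Fin d → ℝ) → ℝ}

theorem add (hf : AuxGood Ω f) (hg : AuxGood Ω g) : AuxGood Ω (fun x => f x + g x) := by
  obtain ⟨hf, C, hC⟩ := hf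
  obtain ⟨hg, C', hC'⟩ := hg
  exact ⟨hf.add hg, C + C', fun x hx =>
    (abs_add_le _ _).trans (add_le_add (hC x hx) (hC' x hx))⟩

theorem mul (hf : AuxGood Ω f) (hg : AuxGood Ω g) : AuxGood Ω (fun x => f x * g x) := by
  obtain ⟨hf, C, hC⟩ := hf
  obtain ⟨hg, C', hC'⟩ := hg
  refine ⟨hf.mul hg, C * C', fun x hx => ?_⟩
  rw [abs_mul]
  exact mul_le_mul (hC x hx) (hC' x hx) (abs_nonneg _) ((abs_nonneg _).trans (hC x hx))

theorem const (c : ℝ) : AuxGood Ω (fun _ => c) :=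
  ⟨continuousOn_const, |c|, fun _ _ => le_rfl⟩

theorem sub (hf : AuxGood Ω f) (hg : AuxGood Ω g) : AuxGood Ω (fun x => f x - g x) := by
  have := hf.add ((AuxGood.const (-1)).mul hg)
  simpa [sub_eq_add_neg] using this

theorem sq (hf : AuxGood Ω f) : AuxGood Ω (fun x => f x ^ 2) := by
  simpa [pow_two] using hf.mul hf

theorem sum {ι : Type*} (s : Finset ι) {F : ι → (Fin d → ℝ) → ℝ}
    (hF : ∀ i, AuxGood Ω (F i)) : AuxGood Ω (fun x => ∑ i ∈ s, F i x) := by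
  classical
  induction s using Finset.induction_on with
  | empty => simpa using AuxGood.const (Ω := Ω) 0
  | insert a s ha ih => simpa [Finset.sum_insert ha] using (hF a).add ih

theorem dot {F G : (Fin d → ℝ) → (Fin d → ℝ)} (hF : ∀ i, AuxGood Ω (fun x => F x i))
    (hG : ∀ i, AuxGood Ω (fun x => G x i)) : AuxGood Ω (fun x => F x ⬝ᵥ G x) :=
  AuxGood.sum _ fun i => (hF i).mul (hG i)

theorem mulVec {M : (Fin d → ℝ) → Matrix (Fin d) (Fin d) ℝ} {G : (Fin d → ℝ) → (Fin d → ℝ)}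
    (hM : ∀ i j, AuxGood Ω (fun x => M x i j)) (hG : ∀ i, AuxGood Ω (fun x => G x i)) (i : Fin d) :
    AuxGood Ω (fun x => (M x).mulVec (G x) i) :=
  AuxGood.dot (F := fun x => M x i) (hM i) hG

theorem of_cont (hΩb : Bornology.IsBounded Ω) (hf : ContinuousOn f (closure Ω)) :
    AuxGood Ω f := by
  obtain ⟨C, hC⟩ := hΩb.isCompact_closure.exists_bound_of_continuousOn hf
  exact ⟨hf.mono subset_closure, C, fun x hx => hC x (subset_closure hx)⟩

theorem of_fderiv (hΩo : IsOpen Ω) (hΩb : Bornology.IsBounded Ω)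
    (hf : ContDiffOn ℝ 1 f (closure Ω)) (e : Fin d → ℝ) :
    AuxGood Ω (fun x => fderiv ℝ f x e) := by
  obtain ⟨C, hC⟩ := aux_fderiv_bdd hΩo hΩb hf
  refine ⟨?_, C * ‖e‖, fun x hx => ?_⟩
  · exact ((hf.mono subset_closure).continuousOn_fderiv_of_isOpen hΩo le_rfl).clm_apply
      continuousOn_const
  · exact ((fderiv ℝ f x).le_opNorm e).trans
      (mul_le_mul_of_nonneg_right (hC x hx) (norm_nonneg _))

theorem integrableOn (hf : AuxGood Ω f) (hΩo : IsOpen Ω) (hΩb : Bornology.IsBounded Ω) :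
    IntegrableOn f Ω := by
  obtain ⟨hf, C, hC⟩ := hf
  refine IntegrableOn.of_bound hΩb.measure_lt_top (hf.aestronglyMeasurable hΩo.measurableSet) C ?_
  exact (ae_restrict_iff' hΩo.measurableSet).2 (Filter.Eventually.of_forall hC)

end AuxGood

theorem aux_div {d : ℕ} (hd : 1 ≤ d) {Ω : Set (Fin d → ℝ)} (hΩo : IsOpen Ω)
    (hΩb : Bornology.IsBounded Ω) {w : (Fin d → ℝ) → ℝ} {q : (Fin d → ℝ) → (Fin d → ℝ)}
    (hw : ContDiffOn ℝ 1 w (closure Ω)) (hw0 : ∀ y ∈ frontier Ω, w y = 0)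
    (hq : ContDiffOn ℝ 1 q (closure Ω)) :
    ∫ x in Ω, (w x * sdiv q x + q x ⬝ᵥ sgrad w x) = 0 := by
  have hqi : ∀ i, ContDiffOn ℝ 1 (fun x => q x i) (closure Ω) := contDiffOn_pi.1 hq
  have hwq : ∀ i, ContDiffOn ℝ 1 (fun x => w x * q x i) (closure Ω) := fun i => hw.mul (hqi i)
  have h1 : ∫ x in Ω, (w x * sdiv q x + q x ⬝ᵥ sgrad w x) =
      ∫ x in Ω, ∑ i, fderiv ℝ (fun y => w y * q y i) x (Pi.single i 1) := by
    refine setIntegral_congr_fun hΩo.measurableSet fun x hx => ?_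
    have hn : closure Ω ∈ nhds x := Filter.mem_of_superset (hΩo.mem_nhds hx) subset_closure
    have hwd : DifferentiableAt ℝ w x := (hw.differentiableOn (by simp)).differentiableAt hn
    simp only [_root_.sdiv, dotProduct, sgrad, Finset.mul_sum]
    rw [← Finset.sum_add_distrib]
    refine Finset.sum_congr rfl fun i _ => ?_
    have hqd : DifferentiableAt ℝ (fun y => q y i) x :=
      ((hqi i).differentiableOn (by simp)).differentiableAt hn
    rw [fderiv_fun_mul hwd hqd]
    simp
  rw [h1, integral_finsetSum]
  · refine Finset.sum_eq_zero fun i _ => ?_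
    exact aux_ibp hd hΩo hΩb (hwq i) (fun y hy => by simp [hw0 y hy]) _
  · intro i _
    exact (AuxGood.of_fderiv hΩo hΩb (hwq i) _).integrableOn hΩo hΩb

theorem aux_dot_nonneg {d : ℕ} (y : Fin d → ℝ) : 0 ≤ y ⬝ᵥ y :=
  Finset.sum_nonneg fun i _ => mul_self_nonneg (y i)

theorem aux_young {d : ℕ} (a b : Fin d → ℝ) {t : ℝ} (ht : 0 < t) :
    a ⬝ᵥ b ≤ t / 2 * (a ⬝ᵥ a) + 1 / (2 * t) * (b ⬝ᵥ b) := by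
  simp only [dotProduct, Finset.mul_sum]
  rw [← Finset.sum_add_distrib]
  refine Finset.sum_le_sum fun i _ => ?_
  have : t / 2 * (a i * a i) + 1 / (2 * t) * (b i * b i) - a i * b i
      = 1 / (2 * t) * (t * a i - b i) ^ 2 := by
    field_simp; ring
  have h2 : 0 ≤ 1 / (2 * t) * (t * a i - b i) ^ 2 := by positivity
  linarith

theorem aux_cs {d : ℕ} (a b : Fin d → ℝ) : (a ⬝ᵥ b) ^ 2 ≤ (a ⬝ᵥ a) * (b ⬝ᵥ b) := by
  have := Finset.sum_mul_sq_le_sq_mul_sq Finset.univ a b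
  simpa [dotProduct, pow_two] using this

theorem aux_A {d : ℕ} (A : Matrix (Fin d) (Fin d) ℝ) {γ : ℝ} (hγ : 0 < γ) (y : Fin d → ℝ)
    (h : γ * (y ⬝ᵥ y) ≤ y ⬝ᵥ A.mulVec y) :
    γ ^ 2 * (y ⬝ᵥ y) ≤ A.mulVec y ⬝ᵥ A.mulVec y := by
  have h0 := aux_dot_nonneg y
  rcases h0.eq_or_lt with h1 | h1
  · rw [← h1]; simpa using aux_dot_nonneg (A.mulVec y)
  · have h2 := aux_cs y (A.mulVec y)
    have h3 : (γ * (y ⬝ᵥ y)) ^ 2 ≤ (y ⬝ᵥ A.mulVec y) ^ 2 :=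
      pow_le_pow_left₀ (by positivity) h 2
    have h4 : (y ⬝ᵥ y) * (γ ^ 2 * (y ⬝ᵥ y)) ≤ (y ⬝ᵥ y) * (A.mulVec y ⬝ᵥ A.mulVec y) := by
      nlinarith
    exact le_of_mul_le_mul_left h4 h1

theorem aux_D {d : ℕ} (D : Matrix (Fin d) (Fin d) ℝ) (hD : D.IsSymm) {l m : ℝ} (hl : 0 < l)
    (hm : l ≤ m)
    (h : ∀ y : Fin d → ℝ, l * (y ⬝ᵥ y) ≤ y ⬝ᵥ D.mulVec y ∧ y ⬝ᵥ D.mulVec y ≤ m * (y ⬝ᵥ y))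
    (y : Fin d → ℝ) : D.mulVec y ⬝ᵥ D.mulVec y ≤ m ^ 2 * (y ⬝ᵥ y) := by
  have hm0 : 0 < m := hl.trans_le hm
  set z := D.mulVec y with hz
  -- nonnegativity of the form at `m • y - z`
  have hsym : y ⬝ᵥ D.mulVec z = z ⬝ᵥ z := by
    rw [Matrix.dotProduct_mulVec, ← Matrix.mulVec_transpose, hD.eq]
  have h1 := (h (m • y - z)).1
  have h1' := aux_dot_nonneg (m • y - z)
  have h2 : 0 ≤ (m • y - z) ⬝ᵥ D.mulVec (m • y - z) := le_trans (by positivity) h1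
  have h3 : (m • y - z) ⬝ᵥ D.mulVec (m • y - z)
      = m ^ 2 * (y ⬝ᵥ z) - 2 * m * (z ⬝ᵥ z) + z ⬝ᵥ D.mulVec z := by
    rw [Matrix.mulVec_sub, Matrix.mulVec_smul, ← hz]
    simp only [sub_dotProduct, dotProduct_sub, smul_dotProduct, dotProduct_smul, smul_eq_mul, hsym]
    ring
  have h4 := (h z).2
  have h5 := (h y).2
  rw [← hz] at h5
  rw [h3] at h2
  have h6 : m ^ 2 * (y ⬝ᵥ z) ≤ m ^ 2 * (m * (y ⬝ᵥ y)) :=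
    mul_le_mul_of_nonneg_left h5 (by positivity)
  have h7 : m * (z ⬝ᵥ z) ≤ m * (m ^ 2 * (y ⬝ᵥ y)) := by linarith
  exact le_of_mul_le_mul_left h7 hm0

theorem aux_final {lmin lmax γ C Cv Cα FA FB NR NS G W P Q : ℝ} (hl : 0 < lmin) (hγ : 0 < γ)
    (hCv : 0 ≤ Cv) (hCα : 0 ≤ Cα) (hR0 : 0 ≤ NR) (hS0 : 0 ≤ NS)
    (hFR : γ ^ 2 * NR ≤ FA) (hFS : γ ^ 2 * NS ≤ FB) (hPF : W ≤ C ^ 2 * G)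
    (hE : lmin * G ≤ ((1 + C ^ 2) / lmin) / 2 * (NR + NS) +
      1 / (2 * ((1 + C ^ 2) / lmin)) * (G + W))
    (hP : P ≤ 2 * NR + 4 * Cv * W + 4 * lmax ^ 2 * G)
    (hQ : Q ≤ 2 * NS + 2 * Cα * W) :
    (W + G ≤ (2 * (1 + C ^ 2) ^ 2 / (γ ^ 2 * lmin ^ 2)) * ((1 / 2) * FA + (1 / 2) * FB)) ∧
    (P ≤ (1 + 2 * Cv * C ^ 2 * (1 + C ^ 2) / lmin ^ 2 + 2 * (1 + C ^ 2) * lmax ^ 2 / lmin ^ 2) *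
        (4 * ((1 / 2) * FA + (1 / 2) * FB) / γ ^ 2)) ∧
    (Q ≤ (1 + Cα * C ^ 2 * (1 + C ^ 2) / lmin ^ 2) *
        (4 * ((1 / 2) * FA + (1 / 2) * FB) / γ ^ 2)) := by
  have hK : 0 < 1 + C ^ 2 := by positivity
  set N := (FA + FB) / γ ^ 2 with hN
  have hγ2 : 0 < γ ^ 2 := by positivity
  have hA : NR + NS ≤ N := by rw [hN, le_div_iff₀ hγ2]; linarith
  -- the gradient bound
  have hG : G ≤ (1 + C ^ 2) * N / lmin ^ 2 := by
    have h1 : 1 / (2 * ((1 + C ^ 2) / lmin)) * (G + W) ≤ lmin / 2 * G := by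
      have : 1 / (2 * ((1 + C ^ 2) / lmin)) * (G + W) ≤
          1 / (2 * ((1 + C ^ 2) / lmin)) * ((1 + C ^ 2) * G) :=
        mul_le_mul_of_nonneg_left (by linarith) (by positivity)
      refine this.trans (le_of_eq ?_)
      field_simp
    have h2 : ((1 + C ^ 2) / lmin) / 2 * (NR + NS) ≤ ((1 + C ^ 2) / lmin) / 2 * N :=
      mul_le_mul_of_nonneg_left hA (by positivity)
    have h3 : lmin * G ≤ (1 + C ^ 2) / lmin * N := by linarith
    have h4 := mul_le_mul_of_nonneg_left h3 hl.le
    have h5 : lmin * ((1 + C ^ 2) / lmin * N) = (1 + C ^ 2) * N := by field_simp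
    rw [le_div_iff₀ (by positivity)]
    nlinarith
  set M := (1 + C ^ 2) * N / lmin ^ 2 with hM
  have hW : W ≤ C ^ 2 * M := hPF.trans (mul_le_mul_of_nonneg_left hG (by positivity))
  refine ⟨?_, ?_, ?_⟩
  · have : (2 * (1 + C ^ 2) ^ 2 / (γ ^ 2 * lmin ^ 2)) * ((1 / 2) * FA + (1 / 2) * FB)
        = (1 + C ^ 2) * M := by
      rw [hM, hN]; field_simp
    rw [this]; linarith
  · have : (1 + 2 * Cv * C ^ 2 * (1 + C ^ 2) / lmin ^ 2 +
        2 * (1 + C ^ 2) * lmax ^ 2 / lmin ^ 2) * (4 * ((1 / 2) * FA + (1 / 2) * FB) / γ ^ 2)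
        = 2 * N + 4 * Cv * (C ^ 2 * M) + 4 * lmax ^ 2 * M := by
      rw [hM, hN]; field_simp; ring
    rw [this]
    have h1 : 4 * Cv * W ≤ 4 * Cv * (C ^ 2 * M) := mul_le_mul_of_nonneg_left hW (by positivity)
    have h2 : 4 * lmax ^ 2 * G ≤ 4 * lmax ^ 2 * M :=
      mul_le_mul_of_nonneg_left hG (by positivity)
    linarith
  · have : (1 + Cα * C ^ 2 * (1 + C ^ 2) / lmin ^ 2) *
        (4 * ((1 / 2) * FA + (1 / 2) * FB) / γ ^ 2) = 2 * N + 2 * Cα * (C ^ 2 * M) := by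
      rw [hM, hN]; field_simp; ring
    rw [this]
    have h1 : 2 * Cα * W ≤ 2 * Cα * (C ^ 2 * M) := mul_le_mul_of_nonneg_left hW (by positivity)
    linarith

/-- For every `w ∈ C¹(Ω̄)` vanishing on `∂Ω` and every `p ∈ C¹(Ω̄; ℝ^d)`,
with `C_v = sup_{x∈Ω} |v(x)|²` and `C_α = sup_{x∈Ω} α(x)²` (encoded as upper bounds),
the following three bounds hold:
(a) `‖w‖²_{L²} + ‖∇w‖²_{L²} ≤ (2(1 + C_pf²)²/(γ_min² λ_min²)) F_Prim(w, p)`;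
(b) `‖p‖²_{L²} ≤ (1 + 2 C_v C_pf²(1 + C_pf²)/λ_min² + 2(1 + C_pf²) λ_max²/λ_min²) ·
    (4 F_Prim(w, p)/γ_min²)`;
(c) `‖div p‖²_{L²} ≤ (1 + C_α C_pf²(1 + C_pf²)/λ_min²) · (4 F_Prim(w, p)/γ_min²)`. -/
theorem bounds_weighted_primitive_LSFEM
    {d : ℕ} (hd : 1 ≤ d)
    (Ω : Set (Fin d → ℝ)) (hΩne : Ω.Nonempty) (hΩo : IsOpen Ω)
    (hΩb : Bornology.IsBounded Ω)
    -- diffusivity tensor: continuous, symmetric, with eigenvalue bounds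
    (Dm : (Fin d → ℝ) → Matrix (Fin d) (Fin d) ℝ)
    (hDcont : ∀ i j, ContinuousOn (fun x => Dm x i j) (closure Ω))
    (hDsymm : ∀ x ∈ closure Ω, (Dm x).IsSymm)
    (lmin lmax : ℝ) (hlmin : 0 < lmin) (hlord : lmin ≤ lmax)
    (hell : ∀ x ∈ closure Ω, ∀ y : Fin d → ℝ,
      lmin * (y ⬝ᵥ y) ≤ y ⬝ᵥ (Dm x).mulVec y ∧ y ⬝ᵥ (Dm x).mulVec y ≤ lmax * (y ⬝ᵥ y))
    -- advection velocity and reaction coefficient: C¹ with the sign restrictions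
    (v : (Fin d → ℝ) → (Fin d → ℝ)) (α : (Fin d → ℝ) → ℝ)
    (hv : ContDiffOn ℝ 1 v (closure Ω)) (hα : ContDiffOn ℝ 1 α (closure Ω))
    (hsign1 : ∀ x ∈ Ω, 0 ≤ α x + sdiv v x)
    (hsign2 : ∀ x ∈ Ω, 0 ≤ α x + (1 / 2) * sdiv v x)
    -- weights: A continuous symmetric positive definite, β continuous positive
    (A : (Fin d → ℝ) → Matrix (Fin d) (Fin d) ℝ)
    (hAcont : ∀ i j, ContinuousOn (fun x => A x i j) (closure Ω))
    (hApd : ∀ x ∈ closure Ω, (A x).PosDef)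
    (β : (Fin d → ℝ) → ℝ) (hβcont : ContinuousOn β (closure Ω))
    (hβpos : ∀ x ∈ closure Ω, 0 < β x)
    -- γ_min = min(1, inf β, inf (smallest eigenvalue of A)); encoded as: γ_min is
    -- positive, at most 1, and bounds β and the spectrum of A from below on Ω
    (γmin : ℝ) (hγpos : 0 < γmin) (hγ1 : γmin ≤ 1)
    (hγβ : ∀ x ∈ Ω, γmin ≤ β x)
    (hγA : ∀ x ∈ Ω, ∀ y : Fin d → ℝ, γmin * (y ⬝ᵥ y) ≤ y ⬝ᵥ (A x).mulVec y)
    -- the Poincaré–Friedrichs inequality with constant C_pf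
    (Cpf : ℝ) (hCpf : 0 < Cpf)
    (hpf : ∀ u : (Fin d → ℝ) → ℝ, ContDiffOn ℝ 1 u (closure Ω) →
      (∀ y ∈ frontier Ω, u y = 0) →
      (∫ x in Ω, (u x) ^ 2) ≤ Cpf ^ 2 * ∫ x in Ω, sgrad u x ⬝ᵥ sgrad u x)
    -- upper bounds C_v for |v|² and C_α for α² on Ω
    (Cv Cα : ℝ)
    (hCv : ∀ x ∈ Ω, v x ⬝ᵥ v x ≤ Cv) (hCα : ∀ x ∈ Ω, (α x) ^ 2 ≤ Cα)
    -- w ∈ C¹(Ω̄) vanishing on ∂Ω and p ∈ C¹(Ω̄; ℝ^d)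
    (w : (Fin d → ℝ) → ℝ) (p : (Fin d → ℝ) → (Fin d → ℝ))
    (hw : ContDiffOn ℝ 1 w (closure Ω)) (hwbd : ∀ y ∈ frontier Ω, w y = 0)
    (hp : ContDiffOn ℝ 1 p (closure Ω)) :
    ((∫ x in Ω, (w x) ^ 2) + (∫ x in Ω, sgrad w x ⬝ᵥ sgrad w x) ≤
      (2 * (1 + Cpf ^ 2) ^ 2 / (γmin ^ 2 * lmin ^ 2)) * FPrim Ω A Dm β α v w p) ∧
    ((∫ x in Ω, p x ⬝ᵥ p x) ≤
      (1 + 2 * Cv * Cpf ^ 2 * (1 + Cpf ^ 2) / lmin ^ 2 +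
        2 * (1 + Cpf ^ 2) * lmax ^ 2 / lmin ^ 2) *
        (4 * FPrim Ω A Dm β α v w p / γmin ^ 2)) ∧
    ((∫ x in Ω, (sdiv p x) ^ 2) ≤
      (1 + Cα * Cpf ^ 2 * (1 + Cpf ^ 2) / lmin ^ 2) *
        (4 * FPrim Ω A Dm β α v w p / γmin ^ 2)) := by
  have hm := hΩo.measurableSet
  have hwd : ∀ x ∈ Ω, DifferentiableAt ℝ w x := fun x hx =>
    (hw.differentiableOn (by simp)).differentiableAt
      (Filter.mem_of_superset (hΩo.mem_nhds hx) subset_closure)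
  have hpi : ∀ i, ContDiffOn ℝ 1 (fun x => p x i) (closure Ω) := contDiffOn_pi.1 hp
  have hvi : ∀ i, ContDiffOn ℝ 1 (fun x => v x i) (closure Ω) := contDiffOn_pi.1 hv
  -- boundedness
  have gw : AuxGood Ω w := .of_cont hΩb hw.continuousOn
  have gα : AuxGood Ω α := .of_cont hΩb hα.continuousOn
  have gβ : AuxGood Ω β := .of_cont hΩb hβcont
  have gp : ∀ i, AuxGood Ω (fun x => p x i) := fun i => .of_cont hΩb (hpi i).continuousOn
  have gv : ∀ i, AuxGood Ω (fun x => v x i) := fun i => .of_cont hΩb (hvi i).continuousOn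
  have gD : ∀ i j, AuxGood Ω (fun x => Dm x i j) := fun i j => .of_cont hΩb (hDcont i j)
  have gA : ∀ i j, AuxGood Ω (fun x => A x i j) := fun i j => .of_cont hΩb (hAcont i j)
  have gg : ∀ i, AuxGood Ω (fun x => sgrad w x i) := fun i => .of_fderiv hΩo hΩb hw _
  have gdp : AuxGood Ω (_root_.sdiv p) := .sum _ fun i => .of_fderiv hΩo hΩb (hpi i) _
  have gdv : AuxGood Ω (_root_.sdiv v) := .sum _ fun i => .of_fderiv hΩo hΩb (hvi i) _
  set R : (Fin d → ℝ) → (Fin d → ℝ) :=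
    fun x i => p x i - w x * v x i + (Dm x).mulVec (sgrad w x) i with hR
  set S : (Fin d → ℝ) → ℝ := fun x => α x * w x + _root_.sdiv p x with hS
  have gR : ∀ i, AuxGood Ω (fun x => R x i) := fun i =>
    ((gp i).sub (gw.mul (gv i))).add (AuxGood.mulVec gD gg i)
  have gS : AuxGood Ω S := (gα.mul gw).add gdp
  have gAR := AuxGood.mulVec gA gR
  have iG := (AuxGood.dot gg gg).integrableOn hΩo hΩb
  have iW := gw.sq.integrableOn hΩo hΩb
  have iR := (AuxGood.dot gR gR).integrableOn hΩo hΩb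
  have iS := gS.sq.integrableOn hΩo hΩb
  have iAR := (AuxGood.dot gAR gAR).integrableOn hΩo hΩb
  have iβS := (gβ.sq.mul gS.sq).integrableOn hΩo hΩb
  have iP := (AuxGood.dot gp gp).integrableOn hΩo hΩb
  have idp := gdp.sq.integrableOn hΩo hΩb
  -- integration by parts
  have T1 := aux_div hd hΩo hΩb hw hwbd hp
  have hw2 : ContDiffOn ℝ 1 (fun x => (1 / 2) * (w x) ^ 2) (closure Ω) :=
    contDiffOn_const.mul (hw.pow 2)
  have T2' := aux_div hd hΩo hΩb hw2 (fun y hy => by simp [hwbd y hy]) hv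
  have T2 : ∫ x in Ω, ((1 / 2) * w x ^ 2 * _root_.sdiv v x + w x * (v x ⬝ᵥ sgrad w x)) = 0 := by
    rw [← T2']
    refine setIntegral_congr_fun hm fun x hx => ?_
    have h1 : sgrad (fun x => (1 / 2) * (w x) ^ 2) x = w x • sgrad w x := by
      funext i
      have h2 : HasFDerivAt (fun x => (1 / 2) * (w x) ^ 2)
          ((1 / 2 : ℝ) • ((2 • w x ^ (2 - 1)) • fderiv ℝ w x)) x :=
        ((hwd x hx).hasFDerivAt.pow 2).const_mul (1 / 2)
      simp only [sgrad, h2.fderiv]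
      simp
      change _ = w x * fderiv ℝ w x (Pi.single i 1)
      ring
    simp only [h1, dotProduct_smul, smul_eq_mul]
  have iT1 : IntegrableOn (fun x => w x * _root_.sdiv p x + p x ⬝ᵥ sgrad w x) Ω :=
    ((gw.mul gdp).add (AuxGood.dot gp gg)).integrableOn hΩo hΩb
  have iT2 : IntegrableOn
      (fun x => (1 / 2) * w x ^ 2 * _root_.sdiv v x + w x * (v x ⬝ᵥ sgrad w x)) Ω :=
    ((((AuxGood.const (1 / 2)).mul gw.sq).mul gdv).add
      (gw.mul (AuxGood.dot gv gg))).integrableOn hΩo hΩb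
  -- the functional bounds the residuals
  have hFR : γmin ^ 2 * (∫ x in Ω, R x ⬝ᵥ R x) ≤
      ∫ x in Ω, (A x).mulVec (R x) ⬝ᵥ (A x).mulVec (R x) := by
    rw [← integral_const_mul]
    exact setIntegral_mono_on (iR.const_mul _) iAR hm fun x hx =>
      aux_A (A x) hγpos (R x) (hγA x hx (R x))
  have hFS : γmin ^ 2 * (∫ x in Ω, S x ^ 2) ≤ ∫ x in Ω, β x ^ 2 * S x ^ 2 := by
    rw [← integral_const_mul]
    refine setIntegral_mono_on (iS.const_mul _) iβS hm fun x hx => ?_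
    have := pow_le_pow_left₀ hγpos.le (hγβ x hx) 2
    exact mul_le_mul_of_nonneg_right this (sq_nonneg _)
  have hF : FPrim Ω A Dm β α v w p =
      (1 / 2) * (∫ x in Ω, (A x).mulVec (R x) ⬝ᵥ (A x).mulVec (R x)) +
      (1 / 2) * ∫ x in Ω, β x ^ 2 * S x ^ 2 := rfl
  have hPF := hpf w hw hwbd
  -- energy estimate
  have hE : lmin * (∫ x in Ω, sgrad w x ⬝ᵥ sgrad w x) ≤
      ((1 + Cpf ^ 2) / lmin) / 2 * ((∫ x in Ω, R x ⬝ᵥ R x) + ∫ x in Ω, S x ^ 2) +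
      1 / (2 * ((1 + Cpf ^ 2) / lmin)) *
        ((∫ x in Ω, sgrad w x ⬝ᵥ sgrad w x) + ∫ x in Ω, w x ^ 2) := by
    have ht : 0 < (1 + Cpf ^ 2) / lmin := by positivity
    generalize (1 + Cpf ^ 2) / lmin = t at ht
    have h1 : ∫ x in Ω, lmin * (sgrad w x ⬝ᵥ sgrad w x) ≤
        ∫ x in Ω, (((t / 2 * (R x ⬝ᵥ R x + S x ^ 2) +
          1 / (2 * t) * (sgrad w x ⬝ᵥ sgrad w x + w x ^ 2)) -
          (w x * _root_.sdiv p x + p x ⬝ᵥ sgrad w x)) +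
          ((1 / 2) * w x ^ 2 * _root_.sdiv v x + w x * (v x ⬝ᵥ sgrad w x))) := by
      refine setIntegral_mono_on (iG.const_mul _)
        (((((iR.add iS).const_mul _).add ((iG.add iW).const_mul _)).sub iT1).add iT2) hm
        fun x hx => ?_
      have e1 := (hell x (subset_closure hx) (sgrad w x)).1
      have e2 := aux_young (R x) (sgrad w x) ht
      have e3 : S x * w x ≤ t / 2 * S x ^ 2 + 1 / (2 * t) * w x ^ 2 := by
        have : t / 2 * S x ^ 2 + 1 / (2 * t) * w x ^ 2 - S x * w x
            = 1 / (2 * t) * (t * S x - w x) ^ 2 := by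
          field_simp; ring
        have h2 : 0 ≤ 1 / (2 * t) * (t * S x - w x) ^ 2 := by positivity
        linarith
      have e4 : R x ⬝ᵥ sgrad w x = p x ⬝ᵥ sgrad w x - w x * (v x ⬝ᵥ sgrad w x) +
          sgrad w x ⬝ᵥ (Dm x).mulVec (sgrad w x) := by
        have : R x = p x - w x • v x + (Dm x).mulVec (sgrad w x) := by
          funext i; simp [hR]
        rw [this, add_dotProduct, sub_dotProduct, smul_dotProduct, smul_eq_mul,
          dotProduct_comm ((Dm x).mulVec (sgrad w x))]
      have e5 : S x * w x = α x * w x ^ 2 + w x * _root_.sdiv p x := by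
        simp only [hS]; ring
      have e6 := mul_nonneg (hsign2 x hx) (sq_nonneg (w x))
      linarith
    rw [integral_const_mul] at h1
    have j0 : IntegrableOn (fun x => t / 2 * (R x ⬝ᵥ R x + S x ^ 2)) Ω :=
      (iR.add iS).const_mul _
    have j1 : IntegrableOn (fun x => 1 / (2 * t) * (sgrad w x ⬝ᵥ sgrad w x + w x ^ 2)) Ω :=
      (iG.add iW).const_mul _
    have j2 : IntegrableOn (fun x => t / 2 * (R x ⬝ᵥ R x + S x ^ 2) +
        1 / (2 * t) * (sgrad w x ⬝ᵥ sgrad w x + w x ^ 2)) Ω := j0.add j1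
    have j3 : IntegrableOn (fun x => t / 2 * (R x ⬝ᵥ R x + S x ^ 2) +
        1 / (2 * t) * (sgrad w x ⬝ᵥ sgrad w x + w x ^ 2) -
        (w x * _root_.sdiv p x + p x ⬝ᵥ sgrad w x)) Ω := j2.sub iT1
    rw [integral_add j3 iT2,
      integral_sub j2 iT1,
      integral_add j0 j1,
      integral_const_mul, integral_const_mul, integral_add iR iS, integral_add iG iW, T1, T2] at h1
    linarith
  have hP : (∫ x in Ω, p x ⬝ᵥ p x) ≤ 2 * (∫ x in Ω, R x ⬝ᵥ R x) +
      4 * Cv * (∫ x in Ω, w x ^ 2) + 4 * lmax ^ 2 * ∫ x in Ω, sgrad w x ⬝ᵥ sgrad w x := by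
    have j2 : IntegrableOn (fun x => 2 * (R x ⬝ᵥ R x) + 4 * Cv * w x ^ 2) Ω :=
      (iR.const_mul _).add (iW.const_mul _)
    rw [← integral_const_mul, ← integral_const_mul, ← integral_const_mul,
      ← integral_add (iR.const_mul _) (iW.const_mul _),
      ← integral_add j2 (iG.const_mul _)]
    refine setIntegral_mono_on iP
      (((iR.const_mul _).add (iW.const_mul _)).add (iG.const_mul _)) hm fun x hx => ?_
    have e1 := aux_D (Dm x) (hDsymm x (subset_closure hx)) hlmin hlord
      (hell x (subset_closure hx)) (sgrad w x)
    have e2 : p x ⬝ᵥ p x ≤ 2 * (R x ⬝ᵥ R x) + 4 * (w x ^ 2 * (v x ⬝ᵥ v x)) +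
        4 * ((Dm x).mulVec (sgrad w x) ⬝ᵥ (Dm x).mulVec (sgrad w x)) := by
      simp only [dotProduct, Finset.mul_sum]
      rw [← Finset.sum_add_distrib, ← Finset.sum_add_distrib]
      refine Finset.sum_le_sum fun i _ => ?_
      simp only [hR]
      generalize (Dm x).mulVec (sgrad w x) i = z
      nlinarith [sq_nonneg (p x i - 2 * (w x * v x i - z)), sq_nonneg (w x * v x i + z)]
    have e3 := mul_le_mul_of_nonneg_left (hCv x hx) (sq_nonneg (w x))
    linarith
  have hDv : (∫ x in Ω, _root_.sdiv p x ^ 2) ≤ 2 * (∫ x in Ω, S x ^ 2) +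
      2 * Cα * ∫ x in Ω, w x ^ 2 := by
    rw [← integral_const_mul, ← integral_const_mul,
      ← integral_add (iS.const_mul _) (iW.const_mul _)]
    refine setIntegral_mono_on idp ((iS.const_mul _).add (iW.const_mul _)) hm fun x hx => ?_
    have e3 := mul_le_mul_of_nonneg_left (hCα x hx) (sq_nonneg (w x))
    simp only [hS]
    nlinarith [sq_nonneg (2 * α x * w x + _root_.sdiv p x)]
  have hR0 : 0 ≤ ∫ x in Ω, R x ⬝ᵥ R x := integral_nonneg fun x => aux_dot_nonneg _
  have hS0 : 0 ≤ ∫ x in Ω, S x ^ 2 := integral_nonneg fun x => sq_nonneg _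
  obtain ⟨x0, hx0⟩ := hΩne
  have hCv0 : 0 ≤ Cv := (aux_dot_nonneg _).trans (hCv x0 hx0)
  have hCα0 : 0 ≤ Cα := (sq_nonneg _).trans (hCα x0 hx0)
  rw [hF]
  clear hF
  generalize (∫ x in Ω, (A x).mulVec (R x) ⬝ᵥ (A x).mulVec (R x)) = FA at *
  generalize (∫ x in Ω, β x ^ 2 * S x ^ 2) = FB at *
  generalize (∫ x in Ω, R x ⬝ᵥ R x) = NR at *
  generalize (∫ x in Ω, S x ^ 2) = NS at *
  generalize (∫ x in Ω, sgrad w x ⬝ᵥ sgrad w x) = G at *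
  generalize (∫ x in Ω, w x ^ 2) = W at *
  generalize (∫ x in Ω, p x ⬝ᵥ p x) = P at *
  generalize (∫ x in Ω, _root_.sdiv p x ^ 2) = Q at *
  exact aux_final hlmin hγpos hCv0 hCα0 hR0 hS0 hFR hFS hPF hE hP hDv
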